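/- Let r, q ≥ 1 and let P_i = (a_{i,1}, …, a_{i,r}) ∈ ℝ^r, i = 1, …, q, be nonzero vectors with nonnegative coordinates. Assume: (i) for every subset T ⊊ {1, …, r} of cardinality t, at most t·⌊q/r⌋ of the vectors P_i have support contained in T; (ii) for all i ≠ i' and j ≠ j', a_{i,j}·a_{i',j'} ≠ a_{i,j'}·a_{i',j} unless both products are 0. Then there exists Q = (b_1, …, b_r) ∈ ℚ^r with strictly positive coordinates such that for every j = 1, …, r, the number of indices i ∈ {1, …, q} for which a_{i,j} > 0 and b_j / a_{i,j} = min_{l : a_{i,l} > 0} b_l / a_{i,l} is at least q/r - (r-1)/2. -/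

import Mathlib

open scoped Classical

noncomputable section

/-- cost of a path written with its endpoint first -/
def pcost {V : Type*} (w : V → V → ℝ) : List V → ℝ
  | [] => 0
  | [_] => 0
  | u :: v :: t => w v u + pcost w (v :: t)

lemma pcost_split {V : Type*} (w : V → V → ℝ) (v : V) (B : List V) :
    ∀ A : List V, pcost w (A ++ v :: B) = pcost w (A ++ [v]) + pcost w (v :: B)
  | [] => by simp [pcost]
  | [x] => by simp [pcost]
  | x :: y :: t => by
      have := pcost_split w v B (y :: t)
      simp only [List.cons_append, pcost] at this ⊢
      linarith

lemma exists_perm_of_path {V : Type*} [Fintype V] (E : V → V → Prop) (w : V → V → ℝ)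
    (hE : ∀ v, E v v) (hw : ∀ v, w v v = 0) :
    ∀ (t : List V) (u v : V), (u :: t).Nodup → (u :: t).IsChain (fun x y => E y x) →
      (u :: t).getLast? = some v →
      ∃ σ : Equiv.Perm V, (∀ x, x ∉ u :: t → σ x = x) ∧ σ u = v ∧ (∀ x, x ≠ u → E x (σ x)) ∧
        ∑ x ∈ Finset.univ.erase u, w x (σ x) = pcost w (u :: t)
  | [], u, v, _, _, hl => by
      refine ⟨1, fun _ _ => rfl, by simpa using hl, fun x _ => hE x, ?_⟩
      simp [pcost, hw]
  | u :: t, u', v, hn, hc, hl => by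
      have hn2 := List.nodup_cons.1 hn
      have hc2 := List.isChain_cons_cons.1 hc
      obtain ⟨σ, h1, h2, h3, h4⟩ := exists_perm_of_path E w hE hw t u v hn2.2 hc2.2
        (by simpa [List.getLast?_cons_cons] using hl)
      have hne : u ≠ u' := by
        rintro rfl; exact hn2.1 (by simp)
      have hu' : σ u' = u' := h1 _ hn2.1
      have e1 : (σ * Equiv.swap u' u) u' = v := by simp [h2]
      have e2 : (σ * Equiv.swap u' u) u = u' := by simp [hu']
      have e3 : ∀ x, x ≠ u → x ≠ u' → (σ * Equiv.swap u' u) x = σ x := by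
        intro x hx hx'
        simp [Equiv.swap_apply_of_ne_of_ne hx' hx]
      refine ⟨σ * Equiv.swap u' u, ?_, e1, ?_, ?_⟩
      · intro x hx
        simp only [List.mem_cons, not_or] at hx
        rw [e3 x hx.2.1 hx.1]
        exact h1 x (by simp [hx.2.1, hx.2.2])
      · intro x hx
        by_cases hxu : x = u
        · subst hxu; rw [e2]; exact hc2.1
        · rw [e3 x hxu hx]; exact h3 x hxu
      · rw [← Finset.add_sum_erase _ _ (show u ∈ Finset.univ.erase u' by simp [hne]), e2]
        rw [← Finset.add_sum_erase _ _ (show u' ∈ Finset.univ.erase u by simp [hne.symm]), hu', hw,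
          zero_add, Finset.erase_right_comm] at h4
        simp only [pcost]
        rw [← h4]
        congr 1
        apply Finset.sum_congr rfl
        intro x hx
        simp only [Finset.mem_erase] at hx
        rw [e3 x (by tauto) (by tauto)]

lemma exists_potential {V : Type*} [Fintype V] (E : V → V → Prop) (w : V → V → ℝ)
    (hE : ∀ v, E v v) (hw : ∀ v, w v v = 0)
    (hσ : ∀ σ : Equiv.Perm V, (∀ x, E x (σ x)) → 0 ≤ ∑ x, w x (σ x)) :
    ∃ p : V → ℝ, ∀ u v, E u v → p v ≤ p u + w u v := by
  let P : V → Set (List V) := fun v => {l | l.Nodup ∧ l.IsChain (fun x y => E y x) ∧ l.head? = some v}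
  have hfin : ∀ v, (P v).Finite := fun v =>
    Set.Finite.subset (List.finite_length_le V (Fintype.card V))
      (fun l hl => hl.1.length_le_card)
  have hne : ∀ v, (P v).Nonempty := fun v => ⟨[v], by simp [P]⟩
  have hmin : ∀ v, ∃ l ∈ P v, ∀ l' ∈ P v, pcost w l ≤ pcost w l' := fun v =>
    Set.exists_min_image (P v) (pcost w) (hfin v) (hne v)
  choose L hL hLmin using hmin
  refine ⟨fun v => pcost w (L v), fun u v huv => ?_⟩
  obtain ⟨t, ht⟩ : ∃ t, L u = u :: t := by
    have := (hL u).2.2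
    cases h : L u with
    | nil => simp [h] at this
    | cons a t => simp [h] at this; exact ⟨t, by rw [this]⟩
  have hLu := hL u
  simp only [ht]
  rw [ht] at hLu
  by_cases hv : v ∈ u :: t
  · obtain ⟨A, B, hAB⟩ := List.append_of_mem hv
    have hsp := pcost_split w v B A
    have hsub : v :: B ∈ P v := by
      have h1 := hLu.1
      have h2 := hLu.2.1
      rw [hAB] at h1 h2
      exact ⟨(List.nodup_append.1 h1).2.1, (List.isChain_append.1 h2).2.1, rfl⟩
    have hpre : (A ++ [v]).Nodup ∧ (A ++ [v]).IsChain (fun x y => E y x) := by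
      have h1 := hLu.1
      have h2 := hLu.2.1
      rw [hAB, show A ++ v :: B = (A ++ [v]) ++ B by simp] at h1 h2
      exact ⟨(List.nodup_append.1 h1).1, (List.isChain_append.1 h2).1⟩
    obtain ⟨t', ht'⟩ : ∃ t', A ++ [v] = u :: t' := by
      cases A with
      | nil => simp at hAB; exact ⟨[], by simp [hAB.1]⟩
      | cons a A => simp at hAB; exact ⟨A ++ [v], by simp [hAB.1]⟩
    have hlast : (A ++ [v]).getLast? = some v := by simp
    rw [ht'] at hpre hsp hlast
    obtain ⟨σ, h1, h2, h3, h4⟩ := exists_perm_of_path E w hE hw t' u v hpre.1 hpre.2 hlast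
    have h5 := hσ σ (fun x => by
      by_cases hx : x = u
      · subst hx; rw [h2]; exact huv
      · exact h3 x hx)
    rw [← Finset.add_sum_erase _ _ (Finset.mem_univ u), h4, h2] at h5
    have h6 := hLmin v _ hsub
    rw [hAB]
    linarith
  · have : v :: u :: t ∈ P v := by
      refine ⟨List.nodup_cons.2 ⟨hv, hLu.1⟩, List.isChain_cons_cons.2 ⟨huv, hLu.2.1⟩, rfl⟩
    have := hLmin v _ this
    simp only [pcost] at this
    linarith

/-- Greedy tie-breaking order. -/
lemma exists_order {q r : ℕ} (S : Fin q → Finset (Fin r)) (F : Fin q → Fin r → ℕ)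
    (hF : ∀ i j, F i j ≠ 0 → j ∈ S i) (hsum : ∀ i, ∑ j, F i j = r)
    (hS : ∀ i i' j j', i ≠ i' → j ≠ j' → j ∈ S i → j' ∈ S i → j ∈ S i' → j' ∈ S i' → False) :
    ∀ (n : ℕ) (R : Finset (Fin r)), R.card = n → ∃ π : Fin r → ℕ, Set.InjOn π R ∧
      ∀ j ∈ R, 2 * ∑ i, F i j ≤ 2 * r * (Finset.univ.filter
        fun i => j ∈ S i ∧ ∀ l ∈ S i, l ∈ R → π l ≤ π j).card + r * (r - 1) := by
  intro n
  induction n with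
  | zero =>
    intro R hR
    rw [Finset.card_eq_zero] at hR
    subst hR
    exact ⟨fun _ => 0, by simp, by simp⟩
  | succ n ih =>
    intro R hR
    let big : Finset (Fin q) := Finset.univ.filter fun i => 2 ≤ (S i ∩ R).card
    have hbig : big.card ≤ R.card.choose 2 := by
      rw [← Finset.card_powersetCard]
      have hex : ∀ i ∈ big, ∃ s, s ⊆ S i ∩ R ∧ s.card = 2 := fun i hi =>
        Finset.exists_subset_card_eq (Finset.mem_filter.1 hi).2
      choose! g hg1 hg2 using hex
      apply Finset.card_le_card_of_injOn g
      · intro i hi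
        exact Finset.mem_coe.2 (Finset.mem_powersetCard.2 ⟨(hg1 i hi).trans Finset.inter_subset_right, hg2 i hi⟩)
      · intro i hi i' hi' hgg
        by_contra hne
        obtain ⟨x, y, hxy, hxy2⟩ := Finset.card_eq_two.1 (hg2 i hi)
        have h1 := hg1 i hi
        have h2 := hg1 i' hi'
        rw [← hgg] at h2
        rw [hxy2] at h1 h2
        have hx1 := h1 (show x ∈ ({x, y} : Finset _) by simp)
        have hy1 := h1 (show y ∈ ({x, y} : Finset _) by simp)
        have hx2 := h2 (show x ∈ ({x, y} : Finset _) by simp)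
        have hy2 := h2 (show y ∈ ({x, y} : Finset _) by simp)
        simp only [Finset.mem_inter] at hx1 hy1 hx2 hy2
        exact hS i i' x y hne hxy hx1.1 hy1.1 hx2.1 hy2.1
    have hRne : R.Nonempty := by
      rw [← Finset.card_pos]; omega
    have hk : ∃ k ∈ R, 2 * ∑ i ∈ big, F i k ≤ r * (R.card - 1) := by
      apply Finset.exists_le_of_sum_le hRne
      rw [← Finset.mul_sum, Finset.sum_comm, Finset.sum_const, smul_eq_mul]
      have : ∑ i ∈ big, ∑ k ∈ R, F i k ≤ big.card * r := by
        rw [← smul_eq_mul, ← Finset.sum_const]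
        apply Finset.sum_le_sum
        intro i _
        exact (Finset.sum_le_sum_of_subset (Finset.subset_univ _)).trans (hsum i).le
      rw [Nat.choose_two_right] at hbig
      have h2 : 2 * big.card ≤ R.card * (R.card - 1) := by omega
      calc _ ≤ 2 * (big.card * r) := by omega
        _ = (2 * big.card) * r := by ring
        _ ≤ (R.card * (R.card - 1)) * r := Nat.mul_le_mul_right _ h2
        _ = _ := by ring
    obtain ⟨k, hkR, hk⟩ := hk
    obtain ⟨π, hπ, hcount⟩ := ih (R.erase k) (by rw [Finset.card_erase_of_mem hkR]; omega)
    refine ⟨fun j => if j = k then 0 else π j + 1, ?_, ?_⟩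
    · intro x hx y hy hxy
      simp only at hxy
      split_ifs at hxy with h1 h2 h2
      · rw [h1, h2]
      · apply hπ <;> simp_all
    · intro j hj
      by_cases hjk : j = k
      · subst hjk
        rw [← Finset.sum_filter_add_sum_filter_not Finset.univ (fun i => 2 ≤ (S i ∩ R).card)]
        have hrest : ∑ i ∈ Finset.univ.filter (fun i => ¬ 2 ≤ (S i ∩ R).card), F i j ≤
            r * (Finset.univ.filter fun i => j ∈ S i ∧ ∀ l ∈ S i, l ∈ R →
              (if l = j then 0 else π l + 1) ≤ (if j = j then 0 else π j + 1)).card := by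
          rw [mul_comm, ← smul_eq_mul, ← Finset.sum_const]
          rw [← Finset.sum_filter_ne_zero]
          refine (Finset.sum_le_sum (g := fun _ => r) ?_).trans
            (Finset.sum_le_sum_of_subset ?_)
          · intro i _
            exact (Finset.single_le_sum (f := F i) (fun _ _ => Nat.zero_le _)
              (Finset.mem_univ j)).trans (hsum i).le
          · intro i hi
            simp only [Finset.mem_filter, Finset.mem_univ, true_and] at hi ⊢
            refine ⟨hF i j hi.2, fun l hl hlR => ?_⟩
            have : l = j := by
              by_contra hne
              apply hi.1
              exact Finset.one_lt_card.2 ⟨l, by simp [hl, hlR], j, by simp [hj, hF i j hi.2], hne⟩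
            simp [this]
        have hle : r * (R.card - 1) ≤ r * (r - 1) := by
          apply Nat.mul_le_mul_left
          have := Finset.card_le_univ R
          simp at this
          omega
        rw [mul_assoc]
        have hk' : 2 * ∑ i ∈ Finset.univ.filter (fun i => 2 ≤ (S i ∩ R).card), F i j ≤ r * (R.card - 1) := hk
        linarith
      · refine (hcount j (by simp [hjk, hj])).trans ?_
        refine Nat.add_le_add_right (Nat.mul_le_mul_left _ (Finset.card_le_card ?_)) _
        intro i hi
        simp only [Finset.mem_filter, Finset.mem_univ, true_and] at hi ⊢
        refine ⟨hi.1, fun l hlS hlR => ?_⟩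
        have hl := hi.2
        by_cases hlk : l = k
        · simp [hlk]
        · simp [hlk, hjk]; exact hl l hlS (by simp [hlk, hlR])

/-- Optimal fractional assignment with dual prices. -/
lemma exists_prices (r q : ℕ) (hr : 1 ≤ r) (hq : 1 ≤ q)
    (a : Fin q → Fin r → ℝ)
    (hnonneg : ∀ i j, 0 ≤ a i j)
    (hsupp : ∀ T : Finset (Fin r), T ≠ Finset.univ →
      (Finset.univ.filter fun i => ∀ j, j ∉ T → a i j = 0).card ≤ T.card * (q / r)) :
    ∃ (B : Fin r → ℝ) (F : Fin q → Fin r → ℕ), (∀ j, 0 < B j) ∧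
      (∀ i, ∑ j, F i j = r) ∧ (∀ j, ∑ i, F i j = q) ∧
      ∀ i j, F i j ≠ 0 → 0 < a i j ∧ ∀ l, 0 < a i l → B j / a i j ≤ B l / a i l := by
  let W : Fin q × Fin r → Fin r × Fin q → ℝ := fun ρ κ => Real.log (a ρ.1 κ.1)
  let Ok : Set (Fin q × Fin r ≃ Fin r × Fin q) := {e | ∀ ρ, 0 < a ρ.1 (e ρ).1}
  have hne : Ok.Nonempty := by
    have hall := (Finset.all_card_le_biUnion_card_iff_exists_injective
      (fun ρ : Fin q × Fin r => (Finset.univ.filter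
        fun κ : Fin r × Fin q => 0 < a ρ.1 κ.1))).1 ?_
    · obtain ⟨f, hf, hf2⟩ := hall
      have hbij : Function.Bijective f :=
        (Fintype.bijective_iff_injective_and_card f).2 ⟨hf, by simp [mul_comm]⟩
      exact ⟨Equiv.ofBijective f hbij, fun ρ => (Finset.mem_filter.1 (hf2 ρ)).2⟩
    · intro A
      let T : Finset (Fin r) := Finset.univ.filter fun j => ∃ ρ ∈ A, 0 < a ρ.1 j
      have h1 : A.biUnion (fun ρ : Fin q × Fin r => (Finset.univ.filter
        fun κ : Fin r × Fin q => 0 < a ρ.1 κ.1)) = T ×ˢ Finset.univ := by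
        ext κ
        simp [T]
      rw [h1, Finset.card_product]
      simp only [Finset.card_univ, Fintype.card_fin]
      by_cases hT : T = Finset.univ
      · rw [hT]
        have := Finset.card_le_univ A
        simp at this ⊢
        linarith
      · have h2 : A ⊆ (Finset.univ.filter fun i => ∀ j, j ∉ T → a i j = 0) ×ˢ Finset.univ := by
          intro ρ hρ
          simp only [Finset.mem_product, Finset.mem_filter, Finset.mem_univ, true_and, and_true]
          intro j hj
          by_contra h
          exact hj (by simp only [T, Finset.mem_filter, Finset.mem_univ, true_and]
                       exact ⟨ρ, hρ, lt_of_le_of_ne (hnonneg _ _) (Ne.symm h)⟩)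
        have h3 := Finset.card_le_card h2
        rw [Finset.card_product] at h3
        simp only [Finset.card_univ, Fintype.card_fin] at h3
        calc A.card ≤ _ := h3
          _ ≤ (T.card * (q / r)) * r := Nat.mul_le_mul_right _ (hsupp T hT)
          _ = T.card * (q / r * r) := by ring
          _ ≤ T.card * q := Nat.mul_le_mul_left _ (Nat.div_mul_le_self q r)
  obtain ⟨e, he, hmax⟩ := Set.exists_max_image Ok (fun e => ∑ ρ, W ρ (e ρ)) (Set.toFinite _) hne
  obtain ⟨p, hp⟩ := exists_potential
    (fun κ κ' : Fin r × Fin q => 0 < a (e.symm κ).1 κ'.1)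
    (fun κ κ' => W (e.symm κ) κ - W (e.symm κ) κ')
    (fun κ => by simpa using he (e.symm κ)) (fun κ => by simp) (by
      intro σ hσ
      have h := hmax (e.trans σ) (fun ρ => by simpa using hσ (e ρ))
      rw [← e.sum_comp]
      simp only [Equiv.symm_apply_apply, Finset.sum_sub_distrib]
      simp only [Equiv.trans_apply] at h
      linarith)
  let z : Fin q := ⟨0, hq⟩
  have hpz : ∀ j t t', p (j, t) ≤ p (j, t') := by
    intro j t t'
    have := hp (j, t') (j, t) (by simpa using he (e.symm (j, t')))
    simpa [W] using this
  refine ⟨fun j => Real.exp (- p (j, z)),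
    fun i j => (Finset.univ.filter fun s => (e (i, s)).1 = j).card,
    fun j => Real.exp_pos _, ?_, ?_, ?_⟩
  · intro i
    rw [← Finset.card_eq_sum_card_fiberwise (fun _ _ => Finset.mem_coe.2 (Finset.mem_univ _))]
    simp
  · intro j
    have h1 : ∑ i, (Finset.univ.filter fun s => (e (i, s)).1 = j).card
        = (Finset.univ.filter fun ρ => (e ρ).1 = j).card := by
      simp only [Finset.card_filter]
      rw [Fintype.sum_prod_type]
    have h2 : (Finset.univ.filter fun ρ => (e ρ).1 = j).card =
        (Finset.univ.filter fun κ : Fin r × Fin q => κ.1 = j).card := by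
      simp only [Finset.card_filter]
      exact e.sum_comp (fun κ => if κ.1 = j then 1 else 0)
    rw [h1, h2, Finset.card_filter, Fintype.sum_prod_type]
    rw [Finset.sum_eq_single j] <;> simp +contextual
  · intro i j hF
    obtain ⟨s, hs⟩ := Finset.card_ne_zero.1 hF
    have hs := (Finset.mem_filter.1 hs).2
    have hpos : 0 < a i j := by have := he (i, s); rwa [hs] at this
    refine ⟨hpos, fun l hl => ?_⟩
    have h := hp (e (i, s)) (l, z) (by simpa using hl)
    simp only [Equiv.symm_apply_apply, W, hs] at h
    have h2 := hpz j (e (i, s)).2 z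
    have h3 : (j, (e (i, s)).2) = e (i, s) := by rw [← hs]
    rw [h3] at h2
    rw [← Real.exp_log hpos, ← Real.exp_log hl, ← Real.exp_sub, ← Real.exp_sub]
    apply Real.exp_le_exp.2
    linarith

end

/-- Main combinatorial content of Lemma 2.2: under the support condition and the
genericity condition on cross ratios, there is a positive rational vector
`Q = (b 1, …, b r)` such that each counting function
`n j = #{ i | a i j > 0 ∧ b j / a i j = min_{l : a i l > 0} b l / a i l }`
is at least `q/r - (r-1)/2`. -/
theorem stmt_9 (r q : ℕ) (hr : 1 ≤ r) (hq : 1 ≤ q)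
    (a : Fin q → Fin r → ℝ)
    (hnonneg : ∀ i j, 0 ≤ a i j)
    (hnz : ∀ i, ∃ j, a i j ≠ 0)
    (hsupp : ∀ T : Finset (Fin r), T ≠ Finset.univ →
      (Finset.univ.filter fun i => ∀ j, j ∉ T → a i j = 0).card ≤ T.card * (q / r))
    (hgen : ∀ i i' : Fin q, ∀ j j' : Fin r, i ≠ i' → j ≠ j' →
      a i j * a i' j' = a i j' * a i' j →
      (a i j * a i' j' = 0 ∧ a i j' * a i' j = 0)) :
    ∃ b : Fin r → ℚ, (∀ j, 0 < b j) ∧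
      ∀ j : Fin r, (q : ℚ) / r - (r - 1) / 2 ≤
        ((Finset.univ.filter fun i =>
          0 < a i j ∧ ∀ l, 0 < a i l →
            (b j : ℝ) / a i j ≤ (b l : ℝ) / a i l).card : ℚ) := by
  obtain ⟨B, F, hB, hrow, hcol, hFS⟩ := exists_prices r q hr hq a hnonneg hsupp
  let S : Fin q → Finset (Fin r) := fun i => Finset.univ.filter fun j =>
    0 < a i j ∧ ∀ l, 0 < a i l → B j / a i j ≤ B l / a i l
  have hSmem : ∀ i j, j ∈ S i ↔ 0 < a i j ∧ ∀ l, 0 < a i l → B j / a i j ≤ B l / a i l := by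
    intro i j; simp [S]
  have hprod : ∀ i j j', j ∈ S i → j' ∈ S i → B j * a i j' = B j' * a i j := by
    intro i j j' h h'
    rw [hSmem] at h h'
    have := le_antisymm (h.2 j' h'.1) (h'.2 j h.1)
    rwa [div_eq_div_iff h.1.ne' h'.1.ne'] at this
  obtain ⟨π, hπ, hcount⟩ := exists_order S F (fun i j h => (hSmem i j).2 (hFS i j h)) hrow
    (by
      intro i i' j j' hi hj h1 h2 h3 h4
      have e1 := hprod i j j' h1 h2
      have e2 := hprod i' j j' h3 h4
      have p1 := ((hSmem _ _).1 h1).1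
      have p4 := ((hSmem _ _).1 h4).1
      have hb := hB j
      have hb' := hB j'
      have key : a i j * a i' j' = a i j' * a i' j := by
        have : (B j * B j') * (a i j * a i' j') = (B j * B j') * (a i j' * a i' j) := by
          linear_combination (-(B j * a i' j')) * e1 + (B j * a i j') * e2
        exact mul_left_cancel₀ (by positivity) this
      have := (hgen i i' j j' hi hj key).1
      exact (mul_pos p1 p4).ne' this) _ Finset.univ rfl
  have hev : ∀ᶠ ε : ℝ in nhdsWithin 0 (Set.Ioi 0), ∀ i j l, j ∈ S i → (∀ m ∈ S i, π m ≤ π j) →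
      0 < a i l → l ≠ j →
      B j * Real.exp (-(ε * π j)) / a i j < B l * Real.exp (-(ε * π l)) / a i l := by
    simp only [Filter.eventually_all]
    intro i j l hj hw hl hne
    have hj' := (hSmem i j).1 hj
    by_cases hlS : l ∈ S i
    · have hlt : π l < π j := lt_of_le_of_ne (hw l hlS) (fun h => hne (hπ (by simp) (by simp) h))
      have heq : B j / a i j = B l / a i l :=
        le_antisymm (hj'.2 l hl) (((hSmem i l).1 hlS).2 j hj'.1)
      filter_upwards [self_mem_nhdsWithin] with ε hε
      rw [mul_div_right_comm, mul_div_right_comm, heq]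
      have : 0 < B l / a i l := div_pos (hB l) hl
      apply mul_lt_mul_of_pos_left _ this
      apply Real.exp_lt_exp.2
      have h1 : (π l : ℝ) < π j := by exact_mod_cast hlt
      have := mul_lt_mul_of_pos_left h1 (show (0:ℝ) < ε from hε)
      linarith
    · have hlt : B j / a i j < B l / a i l := by
        by_contra hcon
        apply hlS
        rw [hSmem]
        exact ⟨hl, fun m hm => (not_lt.1 hcon).trans (hj'.2 m hm)⟩
      apply Filter.Eventually.filter_mono nhdsWithin_le_nhds
      have c1 : Continuous fun ε : ℝ => B j * Real.exp (-(ε * π j)) / a i j := by fun_prop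
      have c2 : Continuous fun ε : ℝ => B l * Real.exp (-(ε * π l)) / a i l := by fun_prop
      apply c1.continuousAt.eventually_lt c2.continuousAt
      simpa using hlt
  obtain ⟨ε, hε⟩ := hev.exists
  have hopen : ∀ᶠ b : Fin r → ℝ in nhds (fun j => B j * Real.exp (-(ε * π j))),
      (∀ j, 0 < b j) ∧ ∀ i j l, j ∈ S i → (∀ m ∈ S i, π m ≤ π j) →
      0 < a i l → l ≠ j → b j / a i j < b l / a i l := by
    rw [Filter.eventually_and]
    simp only [Filter.eventually_all]
    constructor
    · intro j
      have c2 : Continuous fun b : Fin r → ℝ => b j := by fun_prop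
      exact (continuous_const (y := (0:ℝ))).continuousAt.eventually_lt c2.continuousAt
        (mul_pos (hB j) (Real.exp_pos _))
    · intro i j l h1 h2 h3 h4
      have c1 : Continuous fun b : Fin r → ℝ => b j / a i j := by fun_prop
      have c2 : Continuous fun b : Fin r → ℝ => b l / a i l := by fun_prop
      exact c1.continuousAt.eventually_lt c2.continuousAt (hε i j l h1 h2 h3 h4)
  have hdense : DenseRange (Pi.map (fun (_ : Fin r) (x : ℚ) => (x : ℝ))) :=
    DenseRange.piMap (fun _ => Rat.denseRange_cast)
  obtain ⟨b, hbpos, hb⟩ := hdense.exists_mem_open isOpen_interior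
    ⟨_, mem_interior_iff_mem_nhds.2 hopen⟩ |>.imp fun b hb => interior_subset hb
  simp only [Pi.map_apply] at hbpos hb
  refine ⟨b, fun j => by exact_mod_cast hbpos j, fun j => ?_⟩
  have h1 := hcount j (Finset.mem_univ j)
  rw [hcol] at h1
  have h2 : (Finset.univ.filter
        fun i => j ∈ S i ∧ ∀ l ∈ S i, l ∈ Finset.univ → π l ≤ π j).card ≤
      (Finset.univ.filter fun i =>
          0 < a i j ∧ ∀ l, 0 < a i l →
            (b j : ℝ) / a i j ≤ (b l : ℝ) / a i l).card := by
    apply Finset.card_le_card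
    intro i hi
    simp only [Finset.mem_filter, Finset.mem_univ, true_and, forall_true_left] at hi ⊢
    refine ⟨((hSmem i j).1 hi.1).1, fun l hl => ?_⟩
    by_cases hlj : l = j
    · rw [hlj]
    · exact (hb i j l hi.1 hi.2 hl hlj).le
  have h3 := h1.trans (Nat.add_le_add_right (Nat.mul_le_mul_left (2 * r) h2) _)
  generalize (Finset.univ.filter fun i =>
          0 < a i j ∧ ∀ l, 0 < a i l →
            (b j : ℝ) / a i j ≤ (b l : ℝ) / a i l).card = N at h3 ⊢
  have h4 : (2 * q : ℚ) ≤ 2 * r * N + r * (r - 1) := by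
    have : ((2 * q : ℕ) : ℚ) ≤ ((2 * r * N + r * (r - 1) : ℕ) : ℚ) := by exact_mod_cast h3
    push_cast [Nat.cast_sub hr] at this
    exact this
  have hr0 : (0 : ℚ) < r := by exact_mod_cast hr
  rw [sub_le_iff_le_add, div_le_iff₀ hr0]
  linarith
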